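/- (Theorem 2, sufficiency.) Let n ≥ 1, p > 1, and let G = (G¹,…,Gⁿ) : ℝⁿ × ℝⁿ → ℝⁿ have C¹ components that are positively homogeneous of degree 2 in the fiber variable (G^k(x, r·y) = r²·G^k(x,y) for r > 0), so that S is a spray. Let L : ℝⁿ × (ℝⁿ∖{0}) → ℝ be C² with L(x,y) > 0 and L(x, r·y) = r^p·L(x,y) for all r > 0 and all (x,y) with y ≠ 0. Assume the wedge condition ∂L/∂y^i·(δ_S L)_j = ∂L/∂y^j·(δ_S L)_i holds for all indices i, j at every point with y ≠ 0. Then for every a, b ∈ ℝ the deformed Lagrangian F(x,y) = a·L(x,y)^{1/p} + b (real power) satisfies (δ_S F)_i(x,y) = 0 for every index i and every (x,y) with y ≠ 0. -/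

import Mathlib

open scoped BigOperators

noncomputable section

/-- Partial derivative of `f` in the `i`-th base coordinate `x^i`. -/
def pdx (n : ℕ) (f : ((Fin n → ℝ) × (Fin n → ℝ)) → ℝ) (i : Fin n)
    (p : (Fin n → ℝ) × (Fin n → ℝ)) : ℝ :=
  fderiv ℝ f p (Pi.single i 1, 0)

/-- Partial derivative of `f` in the `i`-th fiber coordinate `y^i`. -/
def pdy (n : ℕ) (f : ((Fin n → ℝ) × (Fin n → ℝ)) → ℝ) (i : Fin n)
    (p : (Fin n → ℝ) × (Fin n → ℝ)) : ℝ :=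
  fderiv ℝ f p (0, Pi.single i 1)

/-- The semi-spray with coefficients `G`, acting on functions:
`S(f) = Σ_k y^k ∂f/∂x^k − 2 Σ_k G^k ∂f/∂y^k`. -/
def sprayD (n : ℕ) (G : Fin n → ((Fin n → ℝ) × (Fin n → ℝ)) → ℝ)
    (f : ((Fin n → ℝ) × (Fin n → ℝ)) → ℝ) (p : (Fin n → ℝ) × (Fin n → ℝ)) : ℝ :=
  (∑ k, p.2 k * pdx n f k p) - 2 * ∑ k, G k p * pdy n f k p

/-- The Liouville operator `C(f) = Σ_k y^k ∂f/∂y^k`. -/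
def liouvilleOp (n : ℕ) (f : ((Fin n → ℝ) × (Fin n → ℝ)) → ℝ)
    (p : (Fin n → ℝ) × (Fin n → ℝ)) : ℝ :=
  ∑ k, p.2 k * pdy n f k p

/-- The `i`-th component of the Lagrange differential
`(δ_S L)_i = S(∂L/∂y^i) − ∂L/∂x^i`. -/
def lagDiff (n : ℕ) (G : Fin n → ((Fin n → ℝ) × (Fin n → ℝ)) → ℝ)
    (L : ((Fin n → ℝ) × (Fin n → ℝ)) → ℝ) (i : Fin n)
    (p : (Fin n → ℝ) × (Fin n → ℝ)) : ℝ :=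
  sprayD n G (pdy n L i) p - pdx n L i p

/-- The Lagrangian energy `E_L = C(L) − L`. -/
def lagEnergy (n : ℕ) (L : ((Fin n → ℝ) × (Fin n → ℝ)) → ℝ)
    (p : (Fin n → ℝ) × (Fin n → ℝ)) : ℝ :=
  liouvilleOp n L p - L p

end

theorem aux_sum_x (n : ℕ) (D : ((Fin n → ℝ) × (Fin n → ℝ)) →L[ℝ] ℝ) (y : Fin n → ℝ) :
    ∑ k, y k * D (Pi.single k 1, 0) = D (y, 0) := by
  have h := (D.comp (ContinuousLinearMap.inl ℝ (Fin n → ℝ) (Fin n → ℝ))).toLinearMap.pi_apply_eq_sum_univ y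
  simp only [ContinuousLinearMap.coe_coe, ContinuousLinearMap.comp_apply,
    ContinuousLinearMap.inl_apply, smul_eq_mul] at h
  rw [h]
  refine Finset.sum_congr rfl fun k _ => ?_
  congr 3
  ext j
  simp [Pi.single_apply, eq_comm]

theorem aux_sum_y (n : ℕ) (D : ((Fin n → ℝ) × (Fin n → ℝ)) →L[ℝ] ℝ) (y : Fin n → ℝ) :
    ∑ k, y k * D (0, Pi.single k 1) = D (0, y) := by
  have h := (D.comp (ContinuousLinearMap.inr ℝ (Fin n → ℝ) (Fin n → ℝ))).toLinearMap.pi_apply_eq_sum_univ y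
  simp only [ContinuousLinearMap.coe_coe, ContinuousLinearMap.comp_apply,
    ContinuousLinearMap.inr_apply, smul_eq_mul] at h
  rw [h]
  refine Finset.sum_congr rfl fun k _ => ?_
  congr 3
  ext j
  simp [Pi.single_apply, eq_comm]

theorem aux_spray (n : ℕ) (G : Fin n → ((Fin n → ℝ) × (Fin n → ℝ)) → ℝ)
    (f : ((Fin n → ℝ) × (Fin n → ℝ)) → ℝ) (q : (Fin n → ℝ) × (Fin n → ℝ)) :
    sprayD n G f q = fderiv ℝ f q (q.2, fun k => -2 * G k q) := by
  have e : ((q.2, fun k => -2 * G k q) : (Fin n → ℝ) × (Fin n → ℝ))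
      = (q.2, 0) + (0, fun k => -2 * G k q) := by simp
  rw [e, map_add, ← aux_sum_x, ← aux_sum_y]
  simp only [sprayD, pdx, pdy, Finset.mul_sum, sub_eq_add_neg, ← Finset.sum_neg_distrib]
  congr 1
  exact Finset.sum_congr rfl fun k _ => by ring

theorem stmt10 (n : ℕ) (hn : 1 ≤ n) (pp : ℝ) (hp : 1 < pp)
    (G : Fin n → ((Fin n → ℝ) × (Fin n → ℝ)) → ℝ) (hG : ∀ k, ContDiff ℝ 1 (G k))
    (hGhom : ∀ (k : Fin n) (r : ℝ), 0 < r → ∀ q : (Fin n → ℝ) × (Fin n → ℝ),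
      G k (q.1, r • q.2) = r ^ 2 * G k q)
    (L : ((Fin n → ℝ) × (Fin n → ℝ)) → ℝ)
    (hL : ContDiffOn ℝ 2 L {q : (Fin n → ℝ) × (Fin n → ℝ) | q.2 ≠ 0})
    (hLpos : ∀ q : (Fin n → ℝ) × (Fin n → ℝ), q.2 ≠ 0 → 0 < L q)
    (hhom : ∀ r : ℝ, 0 < r → ∀ q : (Fin n → ℝ) × (Fin n → ℝ), q.2 ≠ 0 →
      L (q.1, r • q.2) = r ^ pp * L q)
    (hwedge : ∀ (i j : Fin n) (q : (Fin n → ℝ) × (Fin n → ℝ)), q.2 ≠ 0 →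
      pdy n L i q * lagDiff n G L j q = pdy n L j q * lagDiff n G L i q) :
    ∀ a b : ℝ, ∀ (i : Fin n) (q : (Fin n → ℝ) × (Fin n → ℝ)), q.2 ≠ 0 →
      lagDiff n G (fun q' => a * L q' ^ (1 / pp) + b) i q = 0 := by
  intro a b i q hq
  have hopen : IsOpen {q : (Fin n → ℝ) × (Fin n → ℝ) | q.2 ≠ 0} :=
    isOpen_ne_fun continuous_snd continuous_const
  have hnhds : ∀ q : (Fin n → ℝ) × (Fin n → ℝ), q.2 ≠ 0 →
      ∀ᶠ z in nhds q, z.2 ≠ 0 := fun q hq => hopen.mem_nhds hq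
  have hLat : ∀ q : (Fin n → ℝ) × (Fin n → ℝ), q.2 ≠ 0 → ContDiffAt ℝ 2 L q :=
    fun q hq => hL.contDiffAt (hopen.mem_nhds hq)
  have hLd : ∀ q : (Fin n → ℝ) × (Fin n → ℝ), q.2 ≠ 0 → DifferentiableAt ℝ L q :=
    fun q hq => (hLat q hq).differentiableAt (by norm_num)
  have hpdy : ∀ j, DifferentiableAt ℝ (pdy n L j) q := by
    intro j
    have h1 : ContDiffAt ℝ 1 (fderiv ℝ L) q := (hLat q hq).fderiv_right (by norm_num)
    have h2 := h1.differentiableAt (by norm_num)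
    exact h2.clm_apply (differentiableAt_const _)
  -- Euler
  have euler : ∀ q : (Fin n → ℝ) × (Fin n → ℝ), q.2 ≠ 0 →
      ∑ k, q.2 k * pdy n L k q = pp * L q := by
    intro q hq
    simp only [pdy]
    rw [aux_sum_y]
    have hc : HasDerivAt (fun r : ℝ => ((q.1, r • q.2) : (Fin n → ℝ) × (Fin n → ℝ)))
        (0, q.2) 1 := by
      have := (hasDerivAt_const (1:ℝ) q.1).prodMk ((hasDerivAt_id (1:ℝ)).smul_const q.2)
      simpa using this
    have hLq : HasFDerivAt L (fderiv ℝ L q) ((fun r : ℝ => ((q.1, r • q.2) : (Fin n → ℝ) × (Fin n → ℝ))) 1) := by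
      simpa using (hLd q hq).hasFDerivAt
    have h1 := hLq.comp_hasDerivAt (1:ℝ) hc
    have h2 : HasDerivAt (fun r : ℝ => r ^ pp * L q) (pp * L q) 1 := by
      have := (Real.hasDerivAt_rpow_const (x := 1) (p := pp) (Or.inl one_ne_zero)).mul_const (L q)
      simpa using this
    refine h1.unique (h2.congr_of_eventuallyEq ?_)
    filter_upwards [lt_mem_nhds (zero_lt_one (α := ℝ))] with r hr
    exact hhom r hr q hq
  set v : (Fin n → ℝ) × (Fin n → ℝ) := (q.2, fun k => -2 * G k q) with hv
  have hSL : fderiv ℝ L q v = (∑ k, q.2 k * pdx n L k q) + ∑ k, (-2 * G k q) * pdy n L k q := by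
    rw [← aux_spray, sprayD, sub_eq_add_neg, Finset.mul_sum, ← Finset.sum_neg_distrib]
    congr 1
    exact Finset.sum_congr rfl fun k _ => by ring
  have hcontr : ∑ j, q.2 j * lagDiff n G L j q = (pp - 1) * fderiv ℝ L q v := by
    have hD1 : HasFDerivAt (fun z : (Fin n → ℝ) × (Fin n → ℝ) => pp * L z)
        (pp • fderiv ℝ L q) q := (hLd q hq).hasFDerivAt.const_mul pp
    have hD2 : HasFDerivAt (fun z : (Fin n → ℝ) × (Fin n → ℝ) => ∑ k, z.2 k * pdy n L k z)
        (∑ k, (q.2 k • fderiv ℝ (pdy n L k) q + pdy n L k q •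
          ((ContinuousLinearMap.proj k).comp (ContinuousLinearMap.snd ℝ (Fin n → ℝ) (Fin n → ℝ))))) q := by
      refine HasFDerivAt.fun_sum fun k _ => ?_
      exact (((ContinuousLinearMap.proj (R := ℝ) (φ := fun _ : Fin n => ℝ) k).comp
        (ContinuousLinearMap.snd ℝ (Fin n → ℝ) (Fin n → ℝ))).hasFDerivAt).mul (hpdy k).hasFDerivAt
    have hE := hD2.unique (hD1.congr_of_eventuallyEq
      ((hnhds q hq).mono fun z hz => euler z hz))
    have hE' := congrArg (fun D => D v) hE
    simp only [ContinuousLinearMap.sum_apply, ContinuousLinearMap.add_apply,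
      ContinuousLinearMap.smul_apply, ContinuousLinearMap.comp_apply, smul_eq_mul,
      ContinuousLinearMap.proj_apply, ContinuousLinearMap.coe_snd', Finset.sum_add_distrib] at hE'
    have h3 : ∑ j, q.2 j * lagDiff n G L j q
        = ∑ j, q.2 j * fderiv ℝ (pdy n L j) q v - ∑ j, q.2 j * pdx n L j q := by
      rw [← Finset.sum_sub_distrib]
      refine Finset.sum_congr rfl fun k _ => ?_
      rw [lagDiff, aux_spray]; ring
    have h4 : ∑ k, pdy n L k q * v.2 k = ∑ k, (-2 * G k q) * pdy n L k q :=
      Finset.sum_congr rfl fun k _ => by rw [hv]; ring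
    rw [h3]
    linarith
  have key : pp * L q * lagDiff n G L i q = (pp - 1) * fderiv ℝ L q v * pdy n L i q := by
    rw [← hcontr, ← euler q hq, Finset.sum_mul, Finset.sum_mul]
    refine Finset.sum_congr rfl fun j _ => ?_
    have := hwedge i j q hq
    linear_combination (-q.2 j) * this
  -- derivative of F
  have hF : ∀ z : (Fin n → ℝ) × (Fin n → ℝ), z.2 ≠ 0 →
      HasFDerivAt (fun q' => a * L q' ^ (1 / pp) + b)
        ((a * (1 / pp * L z ^ (1 / pp - 1))) • fderiv ℝ L z) z := by
    intro z hz
    have h := (((hLd z hz).hasFDerivAt.rpow_const (p := 1 / pp)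
      (Or.inl (hLpos z hz).ne')).const_mul a).add_const b
    simpa [smul_smul] using h
  have hpF : HasFDerivAt (pdy n (fun q' => a * L q' ^ (1 / pp) + b) i)
      ((a * (1 / pp * L q ^ (1 / pp - 1))) • fderiv ℝ (pdy n L i) q +
        pdy n L i q • (a • ((1 / pp) • (((1 / pp - 1) * L q ^ (1 / pp - 1 - 1)) • fderiv ℝ L q)))) q := by
    have h := ((((hLd q hq).hasFDerivAt.rpow_const (p := 1 / pp - 1)
      (Or.inl (hLpos q hq).ne')).const_mul (1 / pp)).const_mul a).mul (hpdy i).hasFDerivAt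
    refine h.congr_of_eventuallyEq ((hnhds q hq).mono fun z hz => ?_)
    simp only [pdy, Pi.mul_apply]
    rw [(hF z hz).fderiv]
    rfl
  have hpow : L q ^ (1 / pp - 1) = L q ^ (1 / pp - 1 - 1) * L q := by
    rw [Real.rpow_sub_one (hLpos q hq).ne' (1 / pp - 1)]
    field_simp [(hLpos q hq).ne']
  rw [lagDiff, aux_spray] at key
  rw [lagDiff, aux_spray, hpF.fderiv, pdx, (hF q hq).fderiv]
  simp only [ContinuousLinearMap.add_apply, ContinuousLinearMap.smul_apply, smul_eq_mul]
  rw [hpow]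
  rw [← hv] at key ⊢
  rw [pdx] at key
  have hpp : pp ≠ 0 := by linarith
  have hone : 1 / pp * pp = 1 := by field_simp
  generalize L q ^ (1 / pp - 1 - 1) = P at *
  field_simp
  linear_combination (a * P) * key
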